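/- A point z₀ ∈ ℂ is a limit of zeros of the polynomials φ_n — that is, there exist z_n ∈ ℂ with φ_n(z_n) = 0 and z_n → z₀ — if and only if z₀ belongs to the support of μ. (Theorem 3.3.) -/

import Mathlib

open Polynomial MeasureTheory Filter

/-- The (topological) support of a measure: the set of points all of whose
neighborhoods have positive measure. -/
def measSupport {X : Type*} [TopologicalSpace X] [MeasurableSpace X]
    (μ : Measure X) : Set X :=
  {x : X | ∀ U ∈ nhds x, 0 < μ U}

open scoped ComplexConjugate

section MultisetInequalities

lemma Multiset.prod_map_sub_prod_map_le {ι : Type*} (s : Multiset ι) {a b : ι → ℝ} {δ : ℝ}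
    (hδ : 0 < δ) (hb : ∀ i ∈ s, 0 ≤ b i) (hba : ∀ i ∈ s, b i ≤ a i) (ha : ∀ i ∈ s, δ ≤ a i) :
    (s.map a).prod - (s.map b).prod ≤ (s.map a).prod * ((s.map fun i => a i - b i).sum / δ) := by
  induction s using Multiset.induction_on with
  | empty => simp
  | cons i s ih =>
    simp only [Multiset.mem_cons, forall_eq_or_imp] at hb hba ha
    have h := ih hb.2 hba.2 ha.2
    have hP : (s.map b).prod ≤ (s.map a).prod := Multiset.prod_map_le_prod_map₀ _ _ hb.2 hba.2
    have hP0 : 0 ≤ (s.map a).prod :=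
      Multiset.prod_map_nonneg fun j hj => (hb.2 j hj).trans (hba.2 j hj)
    simp only [Multiset.map_cons, Multiset.prod_cons, Multiset.sum_cons]
    have h₁ : (s.map a).prod * (a i - b i) ≤
        a i * (s.map a).prod * ((a i - b i) / δ) := by
      rw [mul_div_assoc', le_div_iff₀ hδ]
      nlinarith [mul_nonneg hP0 (sub_nonneg.2 hba.1), ha.1]
    have h₂ := mul_le_mul_of_nonneg_left h (hδ.le.trans ha.1)
    have h₃ := mul_le_mul_of_nonneg_right hP (sub_nonneg.2 hba.1)
    rw [add_div, mul_add]
    nlinarith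

lemma Multiset.sum_map_one_sub_le_neg_log_prod {ι : Type*} (s : Multiset ι) {t : ι → ℝ}
    (ht : ∀ i ∈ s, 0 < t i) :
    (s.map fun i => 1 - t i).sum ≤ -Real.log (s.map t).prod := by
  induction s using Multiset.induction_on with
  | empty => simp
  | cons i s ih =>
    simp only [Multiset.mem_cons, forall_eq_or_imp] at ht
    have hP : 0 < (s.map t).prod := Multiset.prod_pos (by simpa using ht.2)
    simp only [Multiset.map_cons, Multiset.prod_cons, Multiset.sum_cons]
    rw [Real.log_mul ht.1.ne' hP.ne']
    linarith [ih ht.2, Real.log_le_sub_one_of_pos ht.1]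

end MultisetInequalities

section BlaschkeFactors

lemma sq_norm_one_sub_conj_mul_sub_sq_norm_sub (w z : ℂ) :
    ‖1 - conj w * z‖ ^ 2 - ‖z - w‖ ^ 2 = (1 - ‖z‖ ^ 2) * (1 - ‖w‖ ^ 2) := by
  simp only [Complex.sq_norm, Complex.normSq_apply, Complex.sub_re, Complex.sub_im,
    Complex.mul_re, Complex.mul_im, Complex.conj_re, Complex.conj_im, Complex.one_re,
    Complex.one_im]
  ring

lemma norm_sub_le_norm_one_sub_conj_mul {w z : ℂ} (hw : ‖w‖ ≤ 1) (hz : ‖z‖ ≤ 1) :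
    ‖z - w‖ ≤ ‖1 - conj w * z‖ := by
  have h := sq_norm_one_sub_conj_mul_sub_sq_norm_sub w z
  have h₁ : 0 ≤ (1 - ‖z‖ ^ 2) * (1 - ‖w‖ ^ 2) :=
    mul_nonneg (by nlinarith [norm_nonneg z]) (by nlinarith [norm_nonneg w])
  exact le_of_sq_le_sq (by linarith) (norm_nonneg _)

end BlaschkeFactors

lemma Polynomial.eq_of_eval_eq_of_ne_zero {p q : ℂ[X]} (h : ∀ z, z ≠ 0 → p.eval z = q.eval z) : p = q :=
  Polynomial.eq_of_infinite_eval_eq p q <|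
    (Set.finite_singleton (0 : ℂ)).infinite_compl.mono fun z hz => h z hz

/-- The polynomials `φ n`, their reversals `φs n` and the coefficients `α n` satisfy the
Szegő recursion. -/
structure IsSzegoRecursion (α : ℕ → ℂ) (φ φs : ℕ → ℂ[X]) : Prop where
  natDegree_eq : ∀ n, (φ n).natDegree = n
  ne_zero : ∀ n, φ n ≠ 0
  norm_lt_one : ∀ n, ‖α n‖ < 1
  eval_reversed : ∀ n, ∀ z : ℂ, z ≠ 0 → (φs n).eval z = z ^ n * conj ((φ n).eval (conj z)⁻¹)
  succ_eq : ∀ n, φ (n + 1) = C (((√(1 - ‖α n‖ ^ 2) : ℝ) : ℂ))⁻¹ *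
    (X * φ n - C (conj (α n)) * φs n)

/-- The sum `∑ (1 - |w|²)` over the zeros `w` of a polynomial, with multiplicity. -/
noncomputable def blaschkeSum (q : ℂ[X]) : ℝ := (q.roots.map fun w => 1 - ‖w‖ ^ 2).sum

namespace IsSzegoRecursion

variable {α : ℕ → ℂ} {φ φs : ℕ → ℂ[X]}

lemma sqrt_pos (h : IsSzegoRecursion α φ φs) (n : ℕ) : 0 < √(1 - ‖α n‖ ^ 2) :=
  Real.sqrt_pos.2 (by nlinarith [h.norm_lt_one n, norm_nonneg (α n)])

lemma reversed_succ_eq (h : IsSzegoRecursion α φ φs) (n : ℕ) :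
    φs (n + 1) = C (((√(1 - ‖α n‖ ^ 2) : ℝ) : ℂ))⁻¹ * (φs n - C (α n) * (X * φ n)) := by
  refine Polynomial.eq_of_eval_eq_of_ne_zero fun z hz => ?_
  have hz' : (conj z)⁻¹ ≠ 0 := by simpa using hz
  simp only [h.eval_reversed _ z hz, h.succ_eq n, eval_mul, eval_sub, eval_C, eval_X,
    h.eval_reversed n _ hz', map_mul, map_sub, map_inv₀, map_pow, Complex.conj_ofReal,
    Complex.conj_conj, inv_inv, inv_pow]
  field_simp
  ring

lemma eval_reversed_eq (h : IsSzegoRecursion α φ φs) (n : ℕ) (z : ℂ) :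
    (φs n).eval z =
      conj (φ n).leadingCoeff * ((φ n).roots.map fun w => 1 - conj w * z).prod := by
  have key : φs n = C (conj (φ n).leadingCoeff) *
      ((φ n).roots.map fun w => 1 - C (conj w) * X).prod := by
    refine Polynomial.eq_of_eval_eq_of_ne_zero fun z hz => ?_
    have hcard : (φ n).roots.card = n := by
      rw [IsAlgClosed.card_roots_eq_natDegree, h.natDegree_eq]
    rw [h.eval_reversed n z hz, (IsAlgClosed.splits (φ n)).eval_eq_prod_roots, eval_mul, eval_C, eval_multiset_prod, map_mul,
      map_multiset_prod, Multiset.map_map, Multiset.map_map]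
    conv_lhs => enter [1]; rw [← hcard, ← Multiset.prod_replicate, ← Multiset.map_const]
    rw [mul_left_comm, ← Multiset.prod_map_mul]
    congr 3
    ext w
    simp only [Function.const_apply, Function.comp_apply, map_sub, map_inv₀, Complex.conj_conj,
      eval_sub, eval_one, eval_mul, eval_C, eval_X]
    field_simp
  rw [key, eval_mul, eval_C, eval_multiset_prod, Multiset.map_map]
  simp

/-- The diagonal Christoffel–Darboux formula. -/
lemma sq_norm_reversed_sub_sq_norm (h : IsSzegoRecursion α φ φs) (n : ℕ) (z : ℂ) :
    ‖(φs n).eval z‖ ^ 2 - ‖(φ n).eval z‖ ^ 2 =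
      (1 - ‖z‖ ^ 2) * ∑ j ∈ Finset.range n, ‖(φ j).eval z‖ ^ 2 := by
  induction n with
  | zero =>
    have h₀ : (φ 0).roots = 0 := by
      rw [← Multiset.card_eq_zero, IsAlgClosed.card_roots_eq_natDegree, h.natDegree_eq]
    simp [h.eval_reversed_eq 0, (IsAlgClosed.splits (φ 0)).eval_eq_prod_roots, h₀]
  | succ n ih =>
    rw [Finset.sum_range_succ, mul_add, ← ih, h.succ_eq, h.reversed_succ_eq]
    have hρ := h.sqrt_pos n
    have hρ2 : √(1 - ‖α n‖ ^ 2) ^ 2 = 1 - ‖α n‖ ^ 2 :=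
      Real.sq_sqrt (by nlinarith [h.norm_lt_one n, norm_nonneg (α n)])
    have key (a u v : ℂ) : ‖v - a * u‖ ^ 2 - ‖u - conj a * v‖ ^ 2 =
        (1 - ‖a‖ ^ 2) * (‖v‖ ^ 2 - ‖u‖ ^ 2) := by
      simp only [Complex.sq_norm, Complex.normSq_apply, Complex.sub_re, Complex.sub_im,
        Complex.mul_re, Complex.mul_im, Complex.conj_re, Complex.conj_im]
      ring
    have hk := key (α n) (z * (φ n).eval z) ((φs n).eval z)
    simp only [eval_mul, eval_sub, eval_C, eval_X, norm_mul, norm_inv, Complex.norm_real,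
      Real.norm_eq_abs, abs_of_pos hρ, mul_pow, inv_pow] at hk ⊢
    generalize √(1 - ‖α n‖ ^ 2) = ρ at *
    rw [← mul_sub, hk, ← hρ2]
    field_simp
    ring

/-- The zeros of `φ (n + 1)` have product of modulus `|α n|`. -/
lemma norm_prod_roots_succ (h : IsSzegoRecursion α φ φs) (n : ℕ) :
    ((φ (n + 1)).roots.map fun w => ‖w‖).prod = ‖α n‖ := by
  have h₁ : (φ (n + 1)).eval 0 = - (conj (α n) * (φs (n + 1)).eval 0) := by
    rw [h.succ_eq, h.reversed_succ_eq]
    simp only [eval_mul, eval_sub, eval_C, eval_X]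
    ring
  rw [(IsAlgClosed.splits (φ (n + 1))).eval_eq_prod_roots, h.eval_reversed_eq] at h₁
  have h₂ := congrArg norm h₁
  have hl : 0 < ‖(φ (n + 1)).leadingCoeff‖ :=
    norm_pos_iff.2 (leadingCoeff_ne_zero.2 (h.ne_zero _))
  have h₃ : ‖((φ (n + 1)).roots.map fun w => 0 - w).prod‖ =
      ((φ (n + 1)).roots.map fun w => ‖w‖).prod := by
    rw [← normHom_apply, map_multiset_prod, Multiset.map_map]
    simp
  simp only [norm_mul, norm_neg, RCLike.norm_conj, h₃, mul_zero, sub_zero, Multiset.map_const',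
    Multiset.prod_replicate, one_pow, mul_one] at h₂
  rw [mul_comm] at h₂
  exact mul_right_cancel₀ hl.ne' h₂

lemma blaschkeSum_succ_le (h : IsSzegoRecursion α φ φs) (n : ℕ) (hn : α n ≠ 0) :
    blaschkeSum (φ (n + 1)) ≤ -2 * Real.log ‖α n‖ := by
  have hprod := h.norm_prod_roots_succ n
  have hpos : ∀ w ∈ (φ (n + 1)).roots, 0 < ‖w‖ ^ 2 := by
    intro w hw
    rw [sq_pos_iff, norm_ne_zero_iff]
    rintro rfl
    rw [Multiset.prod_eq_zero (Multiset.mem_map.2 ⟨0, hw, norm_zero⟩)] at hprod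
    exact hn (norm_eq_zero.1 hprod.symm)
  have := Multiset.sum_map_one_sub_le_neg_log_prod _ hpos
  rw [Multiset.prod_map_pow, hprod, Real.log_pow] at this
  unfold blaschkeSum
  push_cast at this
  linarith

lemma blaschkeSum_succ_of_eq_zero (h : IsSzegoRecursion α φ φs) (n : ℕ) (hn : α n = 0) :
    blaschkeSum (φ (n + 1)) = 1 + blaschkeSum (φ n) := by
  have h₁ : φ (n + 1) = X * φ n := by simp [h.succ_eq n, hn]
  rw [blaschkeSum, h₁, roots_mul (mul_ne_zero X_ne_zero (h.ne_zero n))]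
  simp [blaschkeSum]

lemma blaschkeSum_le (h : IsSzegoRecursion α φ φs) {c : ℝ} (hc : 0 < c)
    (hcα : ∀ k, α k ≠ 0 → c ≤ ‖α k‖) (n r : ℕ) (hn : α n ≠ 0) :
    blaschkeSum (φ (n + 1 + r)) ≤ -2 * Real.log c + r := by
  have hbound (k : ℕ) (hk : α k ≠ 0) : blaschkeSum (φ (k + 1)) ≤ -2 * Real.log c := by
    linarith [h.blaschkeSum_succ_le k hk, Real.log_le_log hc (hcα k hk)]
  induction r with
  | zero => simpa using hbound n hn
  | succ r ih =>
    rw [← add_assoc]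
    push_cast
    by_cases hk : α (n + 1 + r) = 0
    · linarith [h.blaschkeSum_succ_of_eq_zero _ hk]
    · have : (0 : ℝ) ≤ r := r.cast_nonneg
      linarith [hbound _ hk]

/-- Periodic, not identically zero coefficients: the Blaschke sums are eventually bounded. -/
lemma exists_blaschkeSum_le (h : IsSzegoRecursion α φ φs) {p : ℕ} (hp : 1 ≤ p)
    (hper : Function.Periodic α p) (hnz : ∃ n, α n ≠ 0) :
    ∃ M : ℝ, 0 ≤ M ∧ ∀ᶠ n in atTop, blaschkeSum (φ n) ≤ M := by
  obtain ⟨m, hm⟩ := hnz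
  have hmod (k : ℕ) : α k = α (k % p) := (hper.map_mod_nat k).symm
  obtain ⟨i, hi, hmin⟩ := ((Finset.range p).filter fun k => α k ≠ 0).exists_min_image
    (fun k => ‖α k‖) ⟨m % p, by simp [← hmod, hm, Nat.mod_lt _ hp]⟩
  have hi0 : α i ≠ 0 := (Finset.mem_filter.1 hi).2
  have hc : ∀ k, α k ≠ 0 → ‖α i‖ ≤ ‖α k‖ := fun k hk => by
    rw [hmod k] at hk ⊢
    exact hmin _ (by simp [hk, Nat.mod_lt _ hp])
  refine ⟨-2 * Real.log ‖α i‖ + p, ?_, ?_⟩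
  · have := Real.log_nonpos (norm_nonneg _) (h.norm_lt_one i).le
    have : (0 : ℝ) ≤ p := p.cast_nonneg
    linarith
  · filter_upwards [eventually_ge_atTop (m + 1)] with n hn
    have hα : α (m + (n - (m + 1)) / p * p) ≠ 0 := by
      have := hper.nsmul ((n - (m + 1)) / p) m
      rw [smul_eq_mul] at this
      rwa [this]
    have hr := Nat.mod_lt (n - (m + 1)) hp
    have hsum : m + (n - (m + 1)) / p * p + 1 + (n - (m + 1)) % p = n := by
      have := Nat.div_add_mod' (n - (m + 1)) p
      omega
    have := h.blaschkeSum_le (norm_pos_iff.2 hi0) hc _ ((n - (m + 1)) % p) hα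
    rw [hsum] at this
    have hr' : (((n - (m + 1)) % p : ℕ) : ℝ) ≤ p := by exact_mod_cast hr.le
    linarith

lemma norm_eval_mul_norm_le (h : IsSzegoRecursion α φ φs) {n : ℕ}
    (hroots : ∀ w ∈ (φ n).roots, ‖w‖ < 1) {w z : ℂ} (hw : w ∈ (φ n).roots) (hz : ‖z‖ ≤ 1) :
    ‖(φ n).eval z‖ * ‖1 - conj w * z‖ ≤ ‖z - w‖ * ‖(φs n).eval z‖ := by
  obtain ⟨t, ht⟩ := Multiset.exists_cons_of_mem hw
  have hle : (t.map fun v => ‖z - v‖).prod ≤ (t.map fun v => ‖1 - conj v * z‖).prod :=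
    Multiset.prod_map_le_prod_map₀ _ _ (fun _ _ => norm_nonneg _) fun v hv =>
      norm_sub_le_norm_one_sub_conj_mul (hroots v (ht ▸ Multiset.mem_cons_of_mem hv)).le hz
  have hnorm (f : ℂ → ℂ) : ‖(t.map f).prod‖ = (t.map fun v => ‖f v‖).prod := by
    rw [← normHom_apply, map_multiset_prod, Multiset.map_map]
    simp
  rw [(IsAlgClosed.splits (φ n)).eval_eq_prod_roots, h.eval_reversed_eq, ht]
  simp only [Multiset.map_cons, Multiset.prod_cons, norm_mul, RCLike.norm_conj, hnorm]
  have := mul_le_mul_of_nonneg_left hle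
    (show 0 ≤ ‖(φ n).leadingCoeff‖ * ‖z - w‖ * ‖1 - conj w * z‖ by positivity)
  linarith

lemma eval_reversed_ne_zero (h : IsSzegoRecursion α φ φs) {n : ℕ}
    (hroots : ∀ w ∈ (φ n).roots, ‖w‖ < 1) {z : ℂ} (hz : ‖z‖ ≤ 1) : (φs n).eval z ≠ 0 := by
  rw [h.eval_reversed_eq]
  refine mul_ne_zero (by simpa using h.ne_zero n) fun h0 => ?_
  obtain ⟨w, hw, hwz⟩ := Multiset.mem_map.1 (Multiset.prod_eq_zero_iff.1 h0)
  have h₁ : ‖conj w * z‖ = 1 := by rw [← sub_eq_zero.1 hwz, norm_one]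
  rw [norm_mul, RCLike.norm_conj] at h₁
  nlinarith [hroots w hw, norm_nonneg w]

/-- The pseudohyperbolic distance between zeros of `φ n` and `φ (n + 1)` is at least `|α n|`. -/
lemma norm_mul_norm_le_of_isRoot (h : IsSzegoRecursion α φ φs)
    (hroots : ∀ n, ∀ w ∈ (φ n).roots, ‖w‖ < 1) {n : ℕ} {w v : ℂ}
    (hw : (φ n).IsRoot w) (hv : (φ (n + 1)).IsRoot v) :
    ‖α n‖ * ‖1 - conj w * v‖ ≤ ‖v - w‖ := by
  have hv1 : ‖v‖ < 1 := hroots _ v ((mem_roots (h.ne_zero _)).2 hv)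
  have h₁ : v * (φ n).eval v = conj (α n) * (φs n).eval v := by
    have hρ : (((√(1 - ‖α n‖ ^ 2) : ℝ) : ℂ))⁻¹ ≠ 0 :=
      inv_ne_zero (Complex.ofReal_ne_zero.2 (h.sqrt_pos n).ne')
    rw [h.succ_eq, IsRoot.def, eval_mul, eval_C] at hv
    simpa [sub_eq_zero] using (mul_eq_zero.1 hv).resolve_left hρ
  have h₂ := congrArg norm h₁
  rw [norm_mul, norm_mul, RCLike.norm_conj] at h₂
  have h₃ := h.norm_eval_mul_norm_le (hroots n) ((mem_roots (h.ne_zero _)).2 hw) hv1.le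
  have hpos : 0 < ‖(φs n).eval v‖ := norm_pos_iff.2 (h.eval_reversed_ne_zero (hroots n) hv1.le)
  refine le_of_mul_le_mul_right ?_ hpos
  calc ‖α n‖ * ‖1 - conj w * v‖ * ‖(φs n).eval v‖
      = ‖v‖ * (‖(φ n).eval v‖ * ‖1 - conj w * v‖) := by rw [← mul_assoc, h₂]; ring
    _ ≤ 1 * (‖(φ n).eval v‖ * ‖1 - conj w * v‖) := by gcongr
    _ ≤ ‖v - w‖ * ‖(φs n).eval v‖ := by rwa [one_mul]

lemma sum_sq_norm_le_of_norm_lt_one (h : IsSzegoRecursion α φ φs) {n : ℕ}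
    (hroots : ∀ w ∈ (φ n).roots, ‖w‖ < 1) {δ : ℝ} (hδ : 0 < δ) {z : ℂ} (hz : ‖z‖ < 1)
    (hdist : ∀ w ∈ (φ n).roots, δ ≤ ‖z - w‖) :
    ∑ j ∈ Finset.range n, ‖(φ j).eval z‖ ^ 2 ≤
      ‖(φs n).eval z‖ ^ 2 * (blaschkeSum (φ n) / δ ^ 2) := by
  have hba : ∀ w ∈ (φ n).roots, ‖z - w‖ ^ 2 ≤ ‖1 - conj w * z‖ ^ 2 := fun w hw =>
    pow_le_pow_left₀ (norm_nonneg _)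
      (norm_sub_le_norm_one_sub_conj_mul (hroots w hw).le hz.le) 2
  have hδb : ∀ w ∈ (φ n).roots, δ ^ 2 ≤ ‖z - w‖ ^ 2 := fun w hw =>
    pow_le_pow_left₀ hδ.le (hdist w hw) 2
  have key := Multiset.prod_map_sub_prod_map_le (φ n).roots (pow_pos hδ 2)
    (fun _ _ => sq_nonneg _) hba fun w hw => (hδb w hw).trans (hba w hw)
  have hnorm (f : ℂ → ℂ) :
      ‖((φ n).roots.map f).prod‖ ^ 2 = ((φ n).roots.map fun v => ‖f v‖ ^ 2).prod := by
    rw [← normHom_apply, map_multiset_prod, Multiset.map_map, ← Multiset.prod_map_pow]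
    simp
  have hsum : ((φ n).roots.map fun w => ‖1 - conj w * z‖ ^ 2 - ‖z - w‖ ^ 2).sum =
      (1 - ‖z‖ ^ 2) * blaschkeSum (φ n) := by
    simp only [sq_norm_one_sub_conj_mul_sub_sq_norm_sub, blaschkeSum, Multiset.sum_map_mul_left]
  have hz2 : 0 < 1 - ‖z‖ ^ 2 := by nlinarith [norm_nonneg z]
  refine le_of_mul_le_mul_left ?_ hz2
  rw [← h.sq_norm_reversed_sub_sq_norm, (IsAlgClosed.splits (φ n)).eval_eq_prod_roots,
    h.eval_reversed_eq, norm_mul, norm_mul, RCLike.norm_conj, mul_pow, mul_pow, hnorm, hnorm,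
    ← mul_sub]
  rw [hsum] at key
  refine (mul_le_mul_of_nonneg_left key (sq_nonneg _)).trans_eq ?_
  ring

/-- On an arc whose neighbourhood is free of zeros of `φ n`, the Christoffel–Darboux kernel is
controlled by `|φ n|²`. -/
lemma sum_sq_norm_le_of_norm_eq_one (h : IsSzegoRecursion α φ φs) {n : ℕ}
    (hroots : ∀ w ∈ (φ n).roots, ‖w‖ < 1) {δ : ℝ} (hδ : 0 < δ) {z₀ : ℂ}
    (hdist : ∀ w ∈ (φ n).roots, 2 * δ ≤ ‖w - z₀‖) {z : ℂ} (hz : ‖z‖ = 1) (hzz₀ : ‖z - z₀‖ < δ) :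
    ∑ j ∈ Finset.range n, ‖(φ j).eval z‖ ^ 2 ≤
      ‖(φ n).eval z‖ ^ 2 * (blaschkeSum (φ n) / δ ^ 2) := by
  have hcl : z ∈ closure (Metric.ball z₀ δ ∩ Metric.ball 0 1) := by
    refine Metric.isOpen_ball.inter_closure ⟨by simpa [dist_eq_norm] using hzz₀, ?_⟩
    rw [closure_ball _ one_ne_zero]
    simp [hz]
  have hle := le_on_closure (f := fun z => ∑ j ∈ Finset.range n, ‖(φ j).eval z‖ ^ 2)
    (g := fun z => ‖(φs n).eval z‖ ^ 2 * (blaschkeSum (φ n) / δ ^ 2))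
    (fun v hv => h.sum_sq_norm_le_of_norm_lt_one hroots hδ (by simpa using hv.2) fun w hw => ?_)
    (by fun_prop) (by fun_prop) hcl
  · have hcd := h.sq_norm_reversed_sub_sq_norm n z
    rw [hz, one_pow, sub_self, zero_mul, sub_eq_zero] at hcd
    rwa [← hcd]
  · have hv₀ : ‖v - z₀‖ < δ := by simpa [dist_eq_norm] using hv.1
    have := norm_sub_le_norm_sub_add_norm_sub w v z₀
    rw [norm_sub_rev w v] at this
    linarith [hdist w hw]

end IsSzegoRecursion

section OrthogonalPolynomials

lemma measSupport_eq_support {X : Type*} [TopologicalSpace X] [MeasurableSpace X]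
    (μ : Measure X) : measSupport μ = μ.support := by
  ext x
  exact (Measure.mem_support_iff_forall x).symm

variable {μ : Measure ℂ}

lemma ae_mem_measSupport : ∀ᵐ z ∂μ, z ∈ measSupport μ := by
  rw [measSupport_eq_support]
  exact Measure.support_mem_ae

lemma integrable_of_measSupport_subset_sphere [IsFiniteMeasure μ]
    (hsupp : measSupport μ ⊆ Metric.sphere (0 : ℂ) 1) {E : Type*} [NormedAddCommGroup E]
    {f : ℂ → E} (hf : Continuous f) : Integrable f μ := by
  have h : μ.restrict (Metric.sphere (0 : ℂ) 1) = μ :=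
    Measure.restrict_eq_self_of_ae_mem (ae_mem_measSupport.mono fun z hz => hsupp hz)
  rw [← h]
  exact hf.continuousOn.integrableOn_compact (isCompact_sphere _ _)

variable {φ : ℕ → ℂ[X]}

lemma integral_eval_mul_conj_eval_eq_zero [IsFiniteMeasure μ]
    (hsupp : measSupport μ ⊆ Metric.sphere (0 : ℂ) 1) (hdeg : ∀ n, (φ n).natDegree = n)
    (hne : ∀ n, φ n ≠ 0)
    (horth : ∀ n m, n ≠ m → ∫ z, (φ n).eval z * conj ((φ m).eval z) ∂μ = 0)
    {n : ℕ} {q : ℂ[X]} (hq : q.degree < n) :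
    ∫ z, (φ n).eval z * conj (q.eval z) ∂μ = 0 := by
  suffices ∀ k ≤ n, ∀ q : ℂ[X], q.degree < k → ∫ z, (φ n).eval z * conj (q.eval z) ∂μ = 0 from
    this n le_rfl q hq
  intro k
  induction k with
  | zero =>
    intro _ q hq
    have : q = 0 := by simpa [degree_lt_iff_coeff_zero, Polynomial.ext_iff] using hq
    simp [this]
  | succ k ih =>
    intro hk q hq
    have hl : (φ k).coeff k ≠ 0 := by
      simpa [leadingCoeff, hdeg k] using leadingCoeff_ne_zero.2 (hne k)
    set c : ℂ := q.coeff k / (φ k).coeff k with hc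
    have hr : (q - C c * φ k).degree < k := by
      rw [degree_lt_iff_coeff_zero] at hq ⊢
      intro m hm
      rw [coeff_sub, coeff_C_mul]
      rcases hm.eq_or_lt with rfl | hlt
      · rw [hc, div_mul_cancel₀ _ hl, sub_self]
      · rw [hq m hlt, coeff_eq_zero_of_natDegree_lt (by rwa [hdeg]), mul_zero, sub_zero]
    have hsplit : ∀ z : ℂ, (φ n).eval z * conj (q.eval z) =
        (φ n).eval z * conj ((q - C c * φ k).eval z) +
          conj c * ((φ n).eval z * conj ((φ k).eval z)) := fun z => by
      simp only [eval_sub, eval_mul, eval_C, map_sub, map_mul]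
      ring
    simp_rw [hsplit]
    rw [integral_add
      (integrable_of_measSupport_subset_sphere hsupp (by fun_prop))
      (integrable_of_measSupport_subset_sphere hsupp (by fun_prop)),
      ih (by omega) _ hr, integral_const_mul, horth n k (by omega), mul_zero, add_zero]

lemma integral_sq_norm_eval_eq_one
    (horth : ∀ n, ∫ z, (φ n).eval z * conj ((φ n).eval z) ∂μ = 1) (n : ℕ) :
    ∫ z, ‖(φ n).eval z‖ ^ 2 ∂μ = 1 := by
  have h := horth n
  simp only [Complex.mul_conj, Complex.normSq_eq_norm_sq] at h
  rw [integral_complex_ofReal] at h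
  exact_mod_cast h

/-- If `w` is a zero of `φ n = (X - w) q`, then `(1 - |w|²) ‖q‖² = 1`. -/
lemma one_sub_sq_norm_mul_integral_eq_one [IsFiniteMeasure μ]
    (hsupp : measSupport μ ⊆ Metric.sphere (0 : ℂ) 1) (hdeg : ∀ n, (φ n).natDegree = n)
    (hne : ∀ n, φ n ≠ 0)
    (horth : ∀ n m, ∫ z, (φ n).eval z * conj ((φ m).eval z) ∂μ = if n = m then 1 else 0)
    {n : ℕ} {w : ℂ} {q : ℂ[X]} (hq : φ n = (X - C w) * q) :
    (1 - ‖w‖ ^ 2) * ∫ z, ‖q.eval z‖ ^ 2 ∂μ = 1 := by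
  have hint {E : Type} [NormedAddCommGroup E] {f : ℂ → E} (hf : Continuous f) :
      Integrable f μ := integrable_of_measSupport_subset_sphere hsupp hf
  have hq0 : q ≠ 0 := by rintro rfl; exact hne n (by simpa using hq)
  have hqn : (C w * q).degree < n := by
    have h₁ : q.degree < (φ n).degree := by
      rw [hq, degree_mul, degree_X_sub_C, add_comm, degree_eq_natDegree hq0]
      exact_mod_cast q.natDegree.lt_succ_self
    rw [degree_eq_natDegree (hne n), hdeg] at h₁
    rw [← smul_eq_C_mul]
    exact (degree_smul_le w q).trans_lt h₁
  have hperp := integral_eval_mul_conj_eval_eq_zero hsupp hdeg hne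
    (fun n m hnm => by rw [horth, if_neg hnm]) hqn
  have hre : ∫ z, ((φ n).eval z * conj ((C w * q).eval z)).re ∂μ = 0 := by
    have := Complex.reCLM.integral_comp_comm (μ := μ)
      (φ := fun z => (φ n).eval z * conj ((C w * q).eval z)) (hint (by fun_prop))
    rw [hperp, map_zero] at this
    exact this
  have hae : ∀ᵐ z ∂μ, ‖q.eval z‖ ^ 2 = ‖(φ n).eval z‖ ^ 2 + ‖w‖ ^ 2 * ‖q.eval z‖ ^ 2 +
      2 * ((φ n).eval z * conj ((C w * q).eval z)).re := by
    filter_upwards [ae_mem_measSupport] with z hz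
    have hz1 : ‖z‖ = 1 := by simpa using hsupp hz
    have h₁ : z * q.eval z = (φ n).eval z + (C w * q).eval z := by
      rw [hq]
      simp only [eval_mul, eval_sub, eval_X, eval_C]
      ring
    have h₂ : ‖q.eval z‖ ^ 2 = ‖z * q.eval z‖ ^ 2 := by rw [norm_mul, hz1, one_mul]
    have h₃ : ‖(C w * q).eval z‖ ^ 2 = ‖w‖ ^ 2 * ‖q.eval z‖ ^ 2 := by simp [mul_pow]
    rw [← h₃, h₂, h₁, Complex.sq_norm, Complex.normSq_add, ← Complex.sq_norm, ← Complex.sq_norm]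
  have htot := integral_congr_ae hae
  rw [integral_add (hint (by fun_prop)) (hint (by fun_prop)),
    integral_add (hint (by fun_prop)) (hint (by fun_prop)), integral_const_mul,
    integral_const_mul, hre,
    integral_sq_norm_eval_eq_one (fun n => by rw [horth, if_pos rfl])] at htot
  linarith

lemma norm_lt_one_of_isRoot [IsFiniteMeasure μ]
    (hsupp : measSupport μ ⊆ Metric.sphere (0 : ℂ) 1) (hdeg : ∀ n, (φ n).natDegree = n)
    (hne : ∀ n, φ n ≠ 0)
    (horth : ∀ n m, ∫ z, (φ n).eval z * conj ((φ m).eval z) ∂μ = if n = m then 1 else 0)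
    {n : ℕ} {w : ℂ} (hw : (φ n).IsRoot w) : ‖w‖ < 1 := by
  obtain ⟨q, hq⟩ := dvd_iff_isRoot.2 hw
  have h := one_sub_sq_norm_mul_integral_eq_one hsupp hdeg hne horth hq
  have hQ : 0 ≤ ∫ z, ‖q.eval z‖ ^ 2 ∂μ := integral_nonneg fun _ => sq_nonneg _
  by_contra! hw1
  nlinarith [mul_nonneg hQ (by nlinarith : 0 ≤ ‖w‖ ^ 2 - 1)]

/-- A quantitative form of Fejér's theorem on the zeros of orthogonal polynomials. -/
lemma sq_le_one_sub_sq_norm_of_isRoot [IsFiniteMeasure μ]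
    (hsupp : measSupport μ ⊆ Metric.sphere (0 : ℂ) 1) (hdeg : ∀ n, (φ n).natDegree = n)
    (hne : ∀ n, φ n ≠ 0)
    (horth : ∀ n m, ∫ z, (φ n).eval z * conj ((φ m).eval z) ∂μ = if n = m then 1 else 0)
    {n : ℕ} {w : ℂ} (hw : (φ n).IsRoot w) {d : ℝ} (hd : 0 ≤ d)
    (hdist : ∀ z ∈ measSupport μ, d ≤ ‖z - w‖) : d ^ 2 ≤ 1 - ‖w‖ ^ 2 := by
  obtain ⟨q, hq⟩ := dvd_iff_isRoot.2 hw
  have h := one_sub_sq_norm_mul_integral_eq_one hsupp hdeg hne horth hq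
  have hQ : 0 ≤ ∫ z, ‖q.eval z‖ ^ 2 ∂μ := integral_nonneg fun _ => sq_nonneg _
  have hQ' : 0 < ∫ z, ‖q.eval z‖ ^ 2 ∂μ := hQ.lt_of_ne fun h0 => by simp [← h0] at h
  refine le_of_mul_le_mul_right ?_ hQ'
  rw [h, ← integral_sq_norm_eval_eq_one (fun n => by rw [horth, if_pos rfl]) n,
    ← integral_const_mul]
  refine integral_mono_ae (integrable_of_measSupport_subset_sphere hsupp (by fun_prop))
    (integrable_of_measSupport_subset_sphere hsupp (by fun_prop)) ?_
  filter_upwards [ae_mem_measSupport] with z hz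
  rw [hq, eval_mul, norm_mul, mul_pow, eval_sub, eval_X, eval_C]
  gcongr
  exact hdist z hz

end OrthogonalPolynomials

/-- A nonnegative sequence, bounded by `1`, whose partial sums are frequently bounded by a
multiple of the next term, starts with `0`. -/
lemma eq_zero_of_frequently_sum_range_le {a : ℕ → ℝ} {K : ℝ} (hK : 0 ≤ K)
    (ha : ∀ n, 0 ≤ a n) (ha1 : ∀ n, a n ≤ 1)
    (hfreq : ∃ᶠ n in atTop, ∑ j ∈ Finset.range n, a j ≤ K * a n) : a 0 = 0 := by
  have hsum : Summable a := by
    refine summable_of_sum_range_le (c := K) ha fun n => ?_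
    obtain ⟨m, hm, hnm⟩ := (hfreq.and_eventually (eventually_ge_atTop n)).exists
    calc ∑ j ∈ Finset.range n, a j ≤ ∑ j ∈ Finset.range m, a j :=
          Finset.sum_le_sum_of_subset_of_nonneg (by simpa using hnm) fun j _ _ => ha j
      _ ≤ K * a m := hm
      _ ≤ K := mul_le_of_le_one_right hK (ha1 m)
  refine le_antisymm ?_ (ha 0)
  have hlim : Tendsto (fun n => K * a n) atTop (nhds 0) := by
    simpa using hsum.tendsto_atTop_zero.const_mul K
  refine ge_of_tendsto_of_frequently hlim ?_
  refine (hfreq.and_eventually (eventually_ge_atTop 1)).mono fun n ⟨hn, hn1⟩ => ?_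
  exact (Finset.single_le_sum (fun j _ => ha j) (Finset.mem_range.2 hn1)).trans hn

lemma exists_tendsto_of_eventually_exists_dist_lt {Z : ℕ → Set ℂ}
    (hfin : ∀ n, (Z n).Finite) (hne : ∀ n, 1 ≤ n → (Z n).Nonempty) {z₀ : ℂ}
    (h : ∀ ε > 0, ∀ᶠ n in atTop, ∃ w ∈ Z n, dist w z₀ < ε) :
    ∃ z : ℕ → ℂ, (∀ n, 1 ≤ n → z n ∈ Z n) ∧ Tendsto z atTop (nhds z₀) := by
  have hmin (n : ℕ) : ∃ z, 1 ≤ n → z ∈ Z n ∧ ∀ w ∈ Z n, dist z z₀ ≤ dist w z₀ := by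
    by_cases hn : 1 ≤ n
    · obtain ⟨z, hz⟩ := Set.exists_min_image (Z n) (dist · z₀) (hfin n) (hne n hn)
      exact ⟨z, fun _ => hz⟩
    · exact ⟨0, fun h => absurd h hn⟩
  choose z hz using hmin
  refine ⟨z, fun n hn => (hz n hn).1, Metric.tendsto_nhds.2 fun ε hε => ?_⟩
  filter_upwards [h ε hε, eventually_ge_atTop 1] with n ⟨w, hw, hwε⟩ hn
  exact ((hz n hn).2 w hw).trans_lt hwε

namespace IsSzegoRecursion

variable {α : ℕ → ℂ} {φ φs : ℕ → ℂ[X]}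

lemma tendsto_zero_of_tendsto_isRoot (h : IsSzegoRecursion α φ φs)
    (hroots : ∀ n, ∀ w ∈ (φ n).roots, ‖w‖ < 1) {z : ℕ → ℂ} {z₀ : ℂ} (hz₀ : ‖z₀‖ < 1)
    (hz : ∀ n, 1 ≤ n → (φ n).IsRoot (z n)) (hlim : Tendsto z atTop (nhds z₀)) :
    Tendsto α atTop (nhds 0) := by
  have hlim1 : Tendsto (fun n => z (n + 1)) atTop (nhds z₀) := hlim.comp (tendsto_add_atTop_nat 1)
  have hnum : Tendsto (fun n => ‖z (n + 1) - z n‖) atTop (nhds 0) := by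
    simpa using (hlim1.sub hlim).norm
  have hden : Tendsto (fun n => ‖1 - conj (z n) * z (n + 1)‖) atTop
      (nhds ‖1 - conj z₀ * z₀‖) :=
    (tendsto_const_nhds.sub (((Complex.continuous_conj.tendsto z₀).comp hlim).mul hlim1)).norm
  have hpos : 0 < ‖1 - conj z₀ * z₀‖ := by
    refine norm_pos_iff.2 fun h0 => ?_
    have h₁ : ‖conj z₀ * z₀‖ = 1 := by rw [← sub_eq_zero.1 h0, norm_one]
    rw [norm_mul, RCLike.norm_conj] at h₁
    nlinarith [norm_nonneg z₀]
  have hquot := hnum.div hden hpos.ne'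
  rw [zero_div] at hquot
  refine squeeze_zero_norm' ?_ hquot
  filter_upwards [hden.eventually_const_lt hpos, eventually_ge_atTop 1] with n hn hn1
  exact (le_div_iff₀ hn).2
    (h.norm_mul_norm_le_of_isRoot hroots (hz n hn1) (hz (n + 1) (by omega)))

end IsSzegoRecursion

lemma Function.Periodic.eq_of_tendsto_atTop {X : Type*} [TopologicalSpace X] [T2Space X]
    {f : ℕ → X} {p : ℕ} (hf : Function.Periodic f p) (hp : 1 ≤ p) {a : X}
    (hlim : Tendsto f atTop (nhds a)) (n : ℕ) : f n = a := by
  have hsub : Tendsto (fun k : ℕ => n + k * p) atTop atTop :=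
    tendsto_atTop_mono (fun k => (Nat.le_mul_of_pos_right k hp).trans (Nat.le_add_left _ _)) tendsto_id
  refine tendsto_nhds_unique ?_ (hlim.comp hsub)
  refine tendsto_const_nhds.congr fun k => ?_
  simpa using (hf.nsmul k n).symm

/-- **Theorem 3.3.** For a nontrivial probability measure on the unit circle whose
Verblunsky coefficients are periodic and not all zero, `z₀ ∈ ℂ` is a limit of zeros of
the orthonormal polynomials `φ_n` if and only if `z₀` lies in the support of `μ`. -/
theorem opuc_periodic_limits_of_zeros_eq_support
    (μ : Measure ℂ) [IsProbabilityMeasure μ]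
    (hsupp : measSupport μ ⊆ Metric.sphere (0 : ℂ) 1)
    (hinf : (measSupport μ).Infinite)
    (φ : ℕ → Polynomial ℂ)
    (hdeg : ∀ n, (φ n).natDegree = n)
    (hlead : ∀ n, ∃ c : ℝ, 0 < c ∧ (φ n).leadingCoeff = (c : ℂ))
    (horth : ∀ n m, ∫ z, aeval z (φ n) * starRingEnd ℂ (aeval z (φ m)) ∂μ =
      if n = m then 1 else 0)
    (p : ℕ) (hp : 1 ≤ p)
    (α : ℕ → ℂ)
    (hα : ∀ n, ‖α n‖ < 1)
    (hper : ∀ n, α (n + p) = α n)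
    (hnz : ∃ n, α n ≠ 0)
    (φs : ℕ → Polynomial ℂ)
    (hφs : ∀ n, ∀ z : ℂ, z ≠ 0 →
      aeval z (φs n) = z ^ n * starRingEnd ℂ (aeval ((starRingEnd ℂ z)⁻¹) (φ n)))
    (hφrec : ∀ n, φ (n + 1) =
      C (((Real.sqrt (1 - ‖α n‖ ^ 2) : ℝ) : ℂ))⁻¹ *
        (X * φ n - C (starRingEnd ℂ (α n)) * φs n))
    (z₀ : ℂ) :
    (∃ z : ℕ → ℂ, (∀ n, 1 ≤ n → aeval (z n) (φ n) = 0) ∧ Tendsto z atTop (nhds z₀)) ↔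
      z₀ ∈ measSupport μ := by
  simp only [coe_aeval_eq_eval] at horth hφs ⊢
  have hne (n : ℕ) : φ n ≠ 0 := by
    obtain ⟨c, hc, hcl⟩ := hlead n
    rw [← leadingCoeff_ne_zero, hcl]
    exact_mod_cast hc.ne'
  have hS : IsSzegoRecursion α φ φs := ⟨hdeg, hne, hα, hφs, hφrec⟩
  have hroots : ∀ n, ∀ w ∈ (φ n).roots, ‖w‖ < 1 := fun n w hw =>
    norm_lt_one_of_isRoot hsupp hdeg hne horth (isRoot_of_mem_roots hw)
  constructor
  · rintro ⟨z, hz, hlim⟩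
    have hz1 : ∀ n, 1 ≤ n → ‖z n‖ < 1 := fun n hn =>
      hroots n _ ((mem_roots (hne n)).2 (hz n hn))
    have hz₀ : ‖z₀‖ = 1 := by
      refine le_antisymm (le_of_tendsto hlim.norm ?_) (not_lt.1 fun hlt => ?_)
      · filter_upwards [eventually_ge_atTop 1] with n hn using (hz1 n hn).le
      · obtain ⟨m, hm⟩ := hnz
        exact hm (Function.Periodic.eq_of_tendsto_atTop hper hp
          (hS.tendsto_zero_of_tendsto_isRoot hroots hlt hz hlim) m)
    by_contra hmem
    have hopen : IsOpen (measSupport μ)ᶜ := by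
      rw [measSupport_eq_support]
      exact Measure.isOpen_compl_support
    obtain ⟨ε, hε, hball⟩ := Metric.isOpen_iff.1 hopen z₀ hmem
    have hev : ∀ᶠ n in atTop, (ε / 2) ^ 2 ≤ 1 - ‖z n‖ ^ 2 := by
      filter_upwards [eventually_ge_atTop 1, Metric.tendsto_nhds.1 hlim (ε / 2) (half_pos hε)]
        with n hn hdn
      refine sq_le_one_sub_sq_norm_of_isRoot hsupp hdeg hne horth (hz n hn) (half_pos hε).le
        fun v hv => ?_
      have hv₀ : ε ≤ dist v z₀ := not_lt.1 fun hlt => hball hlt hv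
      rw [← dist_eq_norm]
      linarith [dist_triangle v (z n) z₀]
    have hlim2 : Tendsto (fun n => 1 - ‖z n‖ ^ 2) atTop (nhds (1 - ‖z₀‖ ^ 2)) :=
      tendsto_const_nhds.sub (hlim.norm.pow 2)
    have := ge_of_tendsto hlim2 hev
    rw [hz₀] at this
    nlinarith
  · intro hmem
    refine exists_tendsto_of_eventually_exists_dist_lt (Z := fun n => {w | (φ n).eval w = 0})
      (fun n => ?_) (fun n hn => ?_) fun ε hε => ?_
    · exact finite_setOfPred_isRoot (hne n)
    · refine IsAlgClosed.exists_root (φ n) ?_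
      rw [degree_eq_natDegree (hne n), hdeg]
      exact_mod_cast (by omega : n ≠ 0)
    by_contra hfreq
    rw [not_eventually] at hfreq
    obtain ⟨M, hM, hMev⟩ := hS.exists_blaschkeSum_le hp hper hnz
    set A : Set ℂ := Metric.ball z₀ (ε / 2)
    have hint (n : ℕ) : Integrable (fun z => ‖(φ n).eval z‖ ^ 2) μ :=
      integrable_of_measSupport_subset_sphere hsupp (by fun_prop)
    have hδ : 0 < ε / 2 := half_pos hε
    have ha0 := eq_zero_of_frequently_sum_range_le
      (a := fun n => ∫ z in A, ‖(φ n).eval z‖ ^ 2 ∂μ) (K := M / (ε / 2) ^ 2) (by positivity)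
      (fun n => integral_nonneg fun _ => sq_nonneg _) (fun n => ?_) ?_
    · have hc : ∀ z, (φ 0).eval z = (φ 0).coeff 0 := fun z => by
        rw [eq_C_of_natDegree_eq_zero (hdeg 0)]
        simp
      have hc0 : (φ 0).coeff 0 ≠ 0 := fun h0 =>
        hne 0 (by rw [eq_C_of_natDegree_eq_zero (hdeg 0), h0, C_0])
      have hA : 0 < μ.real A :=
        ENNReal.toReal_pos (hmem A (Metric.ball_mem_nhds _ hδ)).ne' (measure_ne_top _ _)
      simp [hc, hc0, hA.ne'] at ha0
    · refine (setIntegral_le_integral (hint n) (ae_of_all _ fun _ => sq_nonneg _)).trans_eq ?_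
      exact integral_sq_norm_eval_eq_one (fun n => by rw [horth, if_pos rfl]) n
    · refine (hfreq.and_eventually hMev).mono fun n ⟨hn, hnM⟩ => ?_
      push Not at hn
      rw [← integral_finsetSum _ fun j _ => (hint j).integrableOn, ← integral_const_mul]
      refine integral_mono_ae (integrable_finsetSum _ fun j _ => (hint j).integrableOn)
        ((hint n).integrableOn.const_mul _) ?_
      filter_upwards [ae_restrict_of_ae (ae_mem_measSupport (μ := μ)),
        ae_restrict_mem Metric.isOpen_ball.measurableSet] with z hz hzA
      refine (hS.sum_sq_norm_le_of_norm_eq_one (hroots n) hδ (fun w hw => ?_)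
        (by simpa using hsupp hz) (by simpa [A, dist_eq_norm] using hzA)).trans ?_
      · rw [mul_div_cancel₀ _ two_ne_zero, ← dist_eq_norm]
        exact hn w (isRoot_of_mem_roots hw)
      · rw [mul_comm]
        gcongr
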